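/- Let μ₃, μ₆, μ₇ ∈ ℝ, let F : ℝ → ℝ and σ : ℝ → ℝ be smooth, and on the region 0 < t < π/2 of ℝ⁴ define u(t,x,y,z) = σ(x − ln(sin t)) · exp( μ₃ z − (cot t / 2)(μ₆ e^{x−y} + μ₇ e^{x+y}) ). Then u satisfies the Klein–Gordon equation −u_{tt} + sin^{−2}t · u_{xx} + cos^{−2}t · u_{yy} + u_{zz} + (tan t − cot t) u_t + F(x − ln(sin t)) u = 0 on this region if and only if σ satisfies, for all ξ ∈ ℝ, the reduced ordinary differential equation σ″(ξ) − 2 σ′(ξ) + (F(ξ) + μ₃² − μ₆ μ₇ e^{2ξ}) σ(ξ) = 0. -/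

import Mathlib

open Real

/-- Directional (partial) derivative along coordinate `k` on ℝ⁴. -/
noncomputable def pd (k : Fin 4) (f : (Fin 4 → ℝ) → ℝ) (p : Fin 4 → ℝ) : ℝ :=
  fderiv ℝ f p (Pi.single k 1)

lemma pd_eq_aux (k : Fin 4) (f : (Fin 4 → ℝ) → ℝ) (p : Fin 4 → ℝ) (v : ℝ)
    (hf : DifferentiableAt ℝ f p)
    (h : HasDerivAt (fun s => f (Function.update p k s)) v (p k)) : pd k f p = v := by
  have h1 : HasDerivAt (fun s => Function.update p k s) (Pi.single k (1 : ℝ)) (p k) :=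
    hasDerivAt_update p k (p k)
  have h2 : HasFDerivAt f (fderiv ℝ f p) (Function.update p k (p k)) := by
    rw [Function.update_eq_self]; exact hf.hasFDerivAt
  exact (h2.comp_hasDerivAt (p k) h1).unique h

lemma pd2_eq_aux (k : Fin 4) (f g : (Fin 4 → ℝ) → ℝ) (p : Fin 4 → ℝ) (v : ℝ)
    (hf : ContDiffAt ℝ 2 f p)
    (hg : ∀ᶠ q in nhds p, pd k f q = g q)
    (h : HasDerivAt (fun s => g (Function.update p k s)) v (p k)) : pd k (pd k f) p = v := by
  apply pd_eq_aux
  · have h1 : ContDiffAt ℝ 1 (fderiv ℝ f) p := hf.fderiv_right (by norm_num)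
    have h2 : DifferentiableAt ℝ (fderiv ℝ f) p := h1.differentiableAt (by norm_num)
    unfold pd
    exact h2.clm_apply (differentiableAt_const _)
  · refine h.congr_of_eventuallyEq ?_
    have hc : Filter.Tendsto (fun s => Function.update p k s) (nhds (p k)) (nhds p) := by
      have := (hasDerivAt_update p k (p k)).continuousAt
      rw [ContinuousAt, Function.update_eq_self] at this
      exact this
    exact hc.eventually hg

lemma d0_aux (σ : ℝ → ℝ) (d a b S t : ℝ) (hs : Real.sin t ≠ 0)
    (hσ : HasDerivAt σ d (a - Real.log (Real.sin t))) :
    HasDerivAt (fun t => σ (a - Real.log (Real.sin t)) *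
       Real.exp (b - Real.cos t / Real.sin t / 2 * S))
      ((d * (-(Real.cos t / Real.sin t)) + σ (a - Real.log (Real.sin t)) * (S / (2 * Real.sin t ^ 2)))
        * Real.exp (b - Real.cos t / Real.sin t / 2 * S)) t := by
  have h1 : HasDerivAt (fun t => a - Real.log (Real.sin t)) (-(Real.cos t / Real.sin t)) t :=
    ((Real.hasDerivAt_sin t).log hs).const_sub a
  have h2 : HasDerivAt (fun t => b - Real.cos t / Real.sin t / 2 * S) (S / (2 * Real.sin t ^ 2)) t := by
    have := ((((Real.hasDerivAt_cos t).div (Real.hasDerivAt_sin t) hs).div_const 2).mul_const S).const_sub b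
    refine this.congr_deriv ?_
    field_simp
    linear_combination S * Real.sin_sq_add_cos_sq t
  have h3 := (hσ.comp t h1).mul h2.exp
  refine h3.congr_deriv ?_
  simp only [Function.comp]
  ring

lemma d00_aux (σ τ : ℝ → ℝ) (d a b S t : ℝ) (hs : Real.sin t ≠ 0)
    (hσ : HasDerivAt σ (τ (a - Real.log (Real.sin t))) (a - Real.log (Real.sin t)))
    (hτ : HasDerivAt τ d (a - Real.log (Real.sin t))) :
    HasDerivAt (fun t => (τ (a - Real.log (Real.sin t)) * (-(Real.cos t / Real.sin t)) + σ (a - Real.log (Real.sin t)) * (S / (2 * Real.sin t ^ 2)))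
        * Real.exp (b - Real.cos t / Real.sin t / 2 * S))
      ((d * (Real.cos t / Real.sin t) ^ 2 + τ (a - Real.log (Real.sin t)) * (1 / Real.sin t ^ 2)
        - 2 * (Real.cos t / Real.sin t) * τ (a - Real.log (Real.sin t)) * (S / (2 * Real.sin t ^ 2))
        + σ (a - Real.log (Real.sin t)) * (- (S * Real.cos t / Real.sin t ^ 3) + (S / (2 * Real.sin t ^ 2)) ^ 2))
        * Real.exp (b - Real.cos t / Real.sin t / 2 * S)) t := by
  have h1 : HasDerivAt (fun t => a - Real.log (Real.sin t)) (-(Real.cos t / Real.sin t)) t :=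
    ((Real.hasDerivAt_sin t).log hs).const_sub a
  have hk : HasDerivAt (fun t => -(Real.cos t / Real.sin t)) (1 / Real.sin t ^ 2) t := by
    refine ((Real.hasDerivAt_cos t).div (Real.hasDerivAt_sin t) hs).neg.congr_deriv ?_
    field_simp
    linear_combination Real.sin_sq_add_cos_sq t
  have h2 : HasDerivAt (fun t => b - Real.cos t / Real.sin t / 2 * S) (S / (2 * Real.sin t ^ 2)) t := by
    have := ((((Real.hasDerivAt_cos t).div (Real.hasDerivAt_sin t) hs).div_const 2).mul_const S).const_sub b
    refine this.congr_deriv ?_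
    field_simp
    linear_combination S * Real.sin_sq_add_cos_sq t
  have h4 : HasDerivAt (fun t => S / (2 * Real.sin t ^ 2)) (- (S * Real.cos t / Real.sin t ^ 3)) t := by
    have := (hasDerivAt_const t S).div (((Real.hasDerivAt_sin t).pow 2).const_mul 2) (mul_ne_zero two_ne_zero (pow_ne_zero 2 hs))
    refine this.congr_deriv ?_
    simp only [Pi.pow_apply]
    field_simp
    ring
  have h3 := (((hτ.comp t h1).mul hk).add ((hσ.comp t h1).mul h4)).mul h2.exp
  refine h3.congr_deriv ?_
  simp only [Function.comp, Pi.mul_apply, Pi.add_apply]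
  ring

-- exponent with derivative
lemma dg_aux (σ ξ φ : ℝ → ℝ) (d d' φ' t : ℝ)
    (hσ : HasDerivAt σ d (ξ t)) (hξ : HasDerivAt ξ d' t) (hφ : HasDerivAt φ φ' t) :
    HasDerivAt (fun t => σ (ξ t) * Real.exp (φ t))
      ((d * d' + σ (ξ t) * φ') * Real.exp (φ t)) t := by
  refine ((hσ.comp t hξ).mul hφ.exp).congr_deriv ?_
  simp only [Function.comp]
  ring

/-- in the conformally flat Bianchi I spacetime `g = diag(−1, sin²t, cos²t, 1)`,
the invariant ansatz `u = σ(x − ln sin t) exp(μ₃z − (cot t/2)(μ₆e^{x−y} + μ₇e^{x+y}))` solves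
the Klein–Gordon equation with potential `F(x − ln sin t)` on `0 < t < π/2` iff `σ` solves
`σ″ − 2σ′ + (F(ξ) + μ₃² − μ₆μ₇e^{2ξ})σ = 0`. -/
theorem stmt18 (μ₃ μ₆ μ₇ : ℝ) (F σ : ℝ → ℝ)
    (hF : ContDiff ℝ (⊤ : ℕ∞) F) (hσ : ContDiff ℝ (⊤ : ℕ∞) σ)
    (u : (Fin 4 → ℝ) → ℝ)
    (hu : ∀ p : Fin 4 → ℝ,
      u p = σ (p 1 - Real.log (Real.sin (p 0))) *
        Real.exp (μ₃ * p 3 - Real.cot (p 0) / 2 *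
          (μ₆ * Real.exp (p 1 - p 2) + μ₇ * Real.exp (p 1 + p 2)))) :
    (∀ p : Fin 4 → ℝ, p 0 ∈ Set.Ioo 0 (π / 2) →
      -(pd 0 (pd 0 u) p) + (Real.sin (p 0) ^ 2)⁻¹ * pd 1 (pd 1 u) p
        + (Real.cos (p 0) ^ 2)⁻¹ * pd 2 (pd 2 u) p + pd 3 (pd 3 u) p
        + (Real.tan (p 0) - Real.cot (p 0)) * pd 0 u p
        + F (p 1 - Real.log (Real.sin (p 0))) * u p = 0)
    ↔ (∀ ξ : ℝ,
      deriv (deriv σ) ξ - 2 * deriv σ ξ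
        + (F ξ + μ₃ ^ 2 - μ₆ * μ₇ * Real.exp (2 * ξ)) * σ ξ = 0) := by
  have hX : ∀ c x : ℝ, HasDerivAt (fun x => x - c) 1 x := fun c x => (hasDerivAt_id x).sub_const c
  have hS1 : ∀ y x : ℝ, HasDerivAt (fun x => μ₆ * Real.exp (x - y) + μ₇ * Real.exp (x + y))
      (μ₆ * Real.exp (x - y) + μ₇ * Real.exp (x + y)) x := fun y x => by
    refine ((((hasDerivAt_id x).sub_const y).exp.const_mul μ₆).add
      (((hasDerivAt_id x).add_const y).exp.const_mul μ₇)).congr_deriv ?_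
    simp
  have hS2 : ∀ x y : ℝ, HasDerivAt (fun y => μ₆ * Real.exp (x - y) + μ₇ * Real.exp (x + y))
      (-(μ₆ * Real.exp (x - y)) + μ₇ * Real.exp (x + y)) y := fun x y => by
    refine ((((hasDerivAt_id y).const_sub x).exp.const_mul μ₆).add
      (((hasDerivAt_id y).const_add x).exp.const_mul μ₇)).congr_deriv ?_
    simp
  have hS2' : ∀ x y : ℝ, HasDerivAt (fun y => -(μ₆ * Real.exp (x - y)) + μ₇ * Real.exp (x + y))
      (μ₆ * Real.exp (x - y) + μ₇ * Real.exp (x + y)) y := fun x y => by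
    refine ((((hasDerivAt_id y).const_sub x).exp.const_mul μ₆).neg.add
      (((hasDerivAt_id y).const_add x).exp.const_mul μ₇)).congr_deriv ?_
    simp
  have hE1 : ∀ m k y x : ℝ, HasDerivAt (fun x => m - k * (μ₆ * Real.exp (x - y) + μ₇ * Real.exp (x + y)))
      (-(k * (μ₆ * Real.exp (x - y) + μ₇ * Real.exp (x + y)))) x := fun m k y x =>
    ((hS1 y x).const_mul k).const_sub m
  have hE2 : ∀ m k x y : ℝ, HasDerivAt (fun y => m - k * (μ₆ * Real.exp (x - y) + μ₇ * Real.exp (x + y)))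
      (-(k * (-(μ₆ * Real.exp (x - y)) + μ₇ * Real.exp (x + y)))) y := fun m k x y =>
    ((hS2 x y).const_mul k).const_sub m
  have hE3 : ∀ m z : ℝ, HasDerivAt (fun z => μ₃ * z - m) μ₃ z := fun m z => by
    simpa using ((hasDerivAt_id z).const_mul μ₃).sub_const m
  have hu' : u = fun p => σ (p 1 - Real.log (Real.sin (p 0))) *
        Real.exp (μ₃ * p 3 - Real.cos (p 0) / Real.sin (p 0) / 2 *
          (μ₆ * Real.exp (p 1 - p 2) + μ₇ * Real.exp (p 1 + p 2))) := by
    funext p; rw [hu, Real.cot_eq_cos_div_sin]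
  clear hu
  have hσ2 : ContDiff ℝ 2 σ := contDiff_infty.1 hσ 2
  have hd1 : ∀ ξ, HasDerivAt σ (deriv σ ξ) ξ := fun ξ =>
    (hσ2.differentiable (by norm_num) ξ).hasDerivAt
  have hd2 : ∀ ξ, HasDerivAt (deriv σ) (deriv (deriv σ) ξ) ξ := fun ξ => by
    have h1 : ContDiff ℝ 1 (deriv σ) :=
      (contDiff_succ_iff_deriv.1 (show ContDiff ℝ (1 + 1) σ by simpa [one_add_one_eq_two] using hσ2)).2.2
    exact (h1.differentiable (by norm_num) ξ).hasDerivAt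
  have hC : ∀ p : Fin 4 → ℝ, Real.sin (p 0) ≠ 0 → ContDiffAt ℝ 2 u p := by
    intro p hs
    rw [hu']
    fun_prop (disch := assumption)
  have hD : ∀ p : Fin 4 → ℝ, Real.sin (p 0) ≠ 0 → DifferentiableAt ℝ u p :=
    fun p hs => (hC p hs).differentiableAt (by norm_num)
  have hev : ∀ p : Fin 4 → ℝ, Real.sin (p 0) ≠ 0 → ∀ᶠ q : Fin 4 → ℝ in nhds p, Real.sin (q 0) ≠ 0 := by
    intro p hs
    have : ContinuousAt (fun q : Fin 4 → ℝ => Real.sin (q 0)) p :=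
      (Real.continuous_sin.comp (continuous_apply 0)).continuousAt
    exact this.eventually_ne hs
  -- first derivatives
  have p0 : ∀ p : Fin 4 → ℝ, Real.sin (p 0) ≠ 0 → pd 0 u p =
      (deriv σ (p 1 - Real.log (Real.sin (p 0))) * (-(Real.cos (p 0) / Real.sin (p 0)))
        + σ (p 1 - Real.log (Real.sin (p 0))) * ((μ₆ * Real.exp (p 1 - p 2) + μ₇ * Real.exp (p 1 + p 2)) / (2 * Real.sin (p 0) ^ 2)))
        * Real.exp (μ₃ * p 3 - Real.cos (p 0) / Real.sin (p 0) / 2 *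
          (μ₆ * Real.exp (p 1 - p 2) + μ₇ * Real.exp (p 1 + p 2))) := by
    intro p hs
    refine pd_eq_aux 0 u p _ (hD p hs) ?_
    rw [hu']
    simpa [Function.update_apply] using d0_aux σ _ (p 1) (μ₃ * p 3) (μ₆ * Real.exp (p 1 - p 2) + μ₇ * Real.exp (p 1 + p 2)) (p 0) hs (hd1 _)
  have p1 : ∀ p : Fin 4 → ℝ, Real.sin (p 0) ≠ 0 → pd 1 u p =
      (deriv σ (p 1 - Real.log (Real.sin (p 0)))
        + σ (p 1 - Real.log (Real.sin (p 0))) * (-(Real.cos (p 0) / Real.sin (p 0) / 2 * (μ₆ * Real.exp (p 1 - p 2) + μ₇ * Real.exp (p 1 + p 2)))))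
        * Real.exp (μ₃ * p 3 - Real.cos (p 0) / Real.sin (p 0) / 2 *
          (μ₆ * Real.exp (p 1 - p 2) + μ₇ * Real.exp (p 1 + p 2))) := by
    intro p hs
    refine pd_eq_aux 1 u p _ (hD p hs) ?_
    rw [hu']
    simpa [Function.update_apply] using dg_aux σ _ _ _ _ _ (p 1) (hd1 _) (hX _ _) (hE1 _ _ _ _)
  have p2 : ∀ p : Fin 4 → ℝ, Real.sin (p 0) ≠ 0 → pd 2 u p =
      (σ (p 1 - Real.log (Real.sin (p 0))) * (-(Real.cos (p 0) / Real.sin (p 0) / 2 * (-(μ₆ * Real.exp (p 1 - p 2)) + μ₇ * Real.exp (p 1 + p 2)))))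
        * Real.exp (μ₃ * p 3 - Real.cos (p 0) / Real.sin (p 0) / 2 *
          (μ₆ * Real.exp (p 1 - p 2) + μ₇ * Real.exp (p 1 + p 2))) := by
    intro p hs
    refine pd_eq_aux 2 u p _ (hD p hs) ?_
    rw [hu']
    simpa [Function.update_apply] using dg_aux σ _ _ _ _ _ (p 2) (hd1 _) (hasDerivAt_const (p 2) (p 1 - Real.log (Real.sin (p 0)))) (hE2 (μ₃ * p 3) (Real.cos (p 0) / Real.sin (p 0) / 2) (p 1) (p 2))
  have p3 : ∀ p : Fin 4 → ℝ, Real.sin (p 0) ≠ 0 → pd 3 u p =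
      (σ (p 1 - Real.log (Real.sin (p 0))) * μ₃)
        * Real.exp (μ₃ * p 3 - Real.cos (p 0) / Real.sin (p 0) / 2 *
          (μ₆ * Real.exp (p 1 - p 2) + μ₇ * Real.exp (p 1 + p 2))) := by
    intro p hs
    refine pd_eq_aux 3 u p _ (hD p hs) ?_
    rw [hu']
    simpa [Function.update_apply] using dg_aux σ _ _ _ _ _ (p 3) (hd1 _) (hasDerivAt_const (p 3) (p 1 - Real.log (Real.sin (p 0)))) (hE3 (Real.cos (p 0) / Real.sin (p 0) / 2 *
          (μ₆ * Real.exp (p 1 - p 2) + μ₇ * Real.exp (p 1 + p 2))) (p 3))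
  -- second derivatives
  have q0 : ∀ p : Fin 4 → ℝ, Real.sin (p 0) ≠ 0 → pd 0 (pd 0 u) p =
      (deriv (deriv σ) (p 1 - Real.log (Real.sin (p 0))) * (Real.cos (p 0) / Real.sin (p 0)) ^ 2 + deriv σ (p 1 - Real.log (Real.sin (p 0))) * (1 / Real.sin (p 0) ^ 2)
        - 2 * (Real.cos (p 0) / Real.sin (p 0)) * deriv σ (p 1 - Real.log (Real.sin (p 0))) * ((μ₆ * Real.exp (p 1 - p 2) + μ₇ * Real.exp (p 1 + p 2)) / (2 * Real.sin (p 0) ^ 2))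
        + σ (p 1 - Real.log (Real.sin (p 0))) * (-((μ₆ * Real.exp (p 1 - p 2) + μ₇ * Real.exp (p 1 + p 2)) * Real.cos (p 0) / Real.sin (p 0) ^ 3) + ((μ₆ * Real.exp (p 1 - p 2) + μ₇ * Real.exp (p 1 + p 2)) / (2 * Real.sin (p 0) ^ 2)) ^ 2)) * Real.exp (μ₃ * p 3 - Real.cos (p 0) / Real.sin (p 0) / 2 * (μ₆ * Real.exp (p 1 - p 2) + μ₇ * Real.exp (p 1 + p 2))) := by
    intro p hs
    refine pd2_eq_aux 0 u _ p _ (hC p hs) ((hev p hs).mono p0) ?_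
    simp only [Function.update_apply, if_true, Fin.reduceEq, if_false]
    exact d00_aux σ (deriv σ) _ (p 1) (μ₃ * p 3) (μ₆ * Real.exp (p 1 - p 2) + μ₇ * Real.exp (p 1 + p 2)) (p 0) hs (hd1 _) (hd2 _)
  have q1 : ∀ p : Fin 4 → ℝ, Real.sin (p 0) ≠ 0 → pd 1 (pd 1 u) p =
      (deriv (deriv σ) (p 1 - Real.log (Real.sin (p 0))) + 2 * deriv σ (p 1 - Real.log (Real.sin (p 0))) * (-((Real.cos (p 0) / Real.sin (p 0)) / 2 * (μ₆ * Real.exp (p 1 - p 2) + μ₇ * Real.exp (p 1 + p 2))))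
        + σ (p 1 - Real.log (Real.sin (p 0))) * (-((Real.cos (p 0) / Real.sin (p 0)) / 2 * (μ₆ * Real.exp (p 1 - p 2) + μ₇ * Real.exp (p 1 + p 2))) + ((Real.cos (p 0) / Real.sin (p 0)) / 2 * (μ₆ * Real.exp (p 1 - p 2) + μ₇ * Real.exp (p 1 + p 2))) ^ 2)) * Real.exp (μ₃ * p 3 - Real.cos (p 0) / Real.sin (p 0) / 2 * (μ₆ * Real.exp (p 1 - p 2) + μ₇ * Real.exp (p 1 + p 2))) := by
    intro p hs
    refine pd2_eq_aux 1 u _ p _ (hC p hs) ((hev p hs).mono p1) ?_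
    simp only [Function.update_apply, if_true, Fin.reduceEq, if_false]
    have hx := hX (Real.log (Real.sin (p 0))) (p 1)
    have hk := ((hS1 (p 2) (p 1)).const_mul ((Real.cos (p 0) / Real.sin (p 0)) / 2)).neg
    refine ((((hd2 (p 1 - Real.log (Real.sin (p 0)))).comp (p 1) hx).add (((hd1 (p 1 - Real.log (Real.sin (p 0)))).comp (p 1) hx).mul hk)).mul
      (hE1 (μ₃ * p 3) ((Real.cos (p 0) / Real.sin (p 0)) / 2) (p 2) (p 1)).exp).congr_deriv ?_
    simp only [Function.comp, Pi.mul_apply, Pi.add_apply, Pi.neg_apply]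
    ring
  have q2 : ∀ p : Fin 4 → ℝ, Real.sin (p 0) ≠ 0 → pd 2 (pd 2 u) p =
      (σ (p 1 - Real.log (Real.sin (p 0))) * (-((Real.cos (p 0) / Real.sin (p 0)) / 2 * (μ₆ * Real.exp (p 1 - p 2) + μ₇ * Real.exp (p 1 + p 2))) + ((Real.cos (p 0) / Real.sin (p 0)) / 2 * (-(μ₆ * Real.exp (p 1 - p 2)) + μ₇ * Real.exp (p 1 + p 2))) ^ 2)) * Real.exp (μ₃ * p 3 - Real.cos (p 0) / Real.sin (p 0) / 2 * (μ₆ * Real.exp (p 1 - p 2) + μ₇ * Real.exp (p 1 + p 2))) := by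
    intro p hs
    refine pd2_eq_aux 2 u _ p _ (hC p hs) ((hev p hs).mono p2) ?_
    simp only [Function.update_apply, if_true, Fin.reduceEq, if_false]
    have hk := ((hS2' (p 1) (p 2)).const_mul ((Real.cos (p 0) / Real.sin (p 0)) / 2)).neg
    refine ((hk.const_mul (σ (p 1 - Real.log (Real.sin (p 0))))).mul
      (hE2 (μ₃ * p 3) ((Real.cos (p 0) / Real.sin (p 0)) / 2) (p 1) (p 2)).exp).congr_deriv ?_
    simp only [Pi.neg_apply]
    ring
  have q3 : ∀ p : Fin 4 → ℝ, Real.sin (p 0) ≠ 0 → pd 3 (pd 3 u) p =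
      (σ (p 1 - Real.log (Real.sin (p 0))) * μ₃ ^ 2) * Real.exp (μ₃ * p 3 - Real.cos (p 0) / Real.sin (p 0) / 2 * (μ₆ * Real.exp (p 1 - p 2) + μ₇ * Real.exp (p 1 + p 2))) := by
    intro p hs
    refine pd2_eq_aux 3 u _ p _ (hC p hs) ((hev p hs).mono p3) ?_
    simp only [Function.update_apply, if_true, Fin.reduceEq, if_false]
    refine ((hE3 ((Real.cos (p 0) / Real.sin (p 0)) / 2 * (μ₆ * Real.exp (p 1 - p 2) + μ₇ * Real.exp (p 1 + p 2))) (p 3)).exp.const_mul (σ (p 1 - Real.log (Real.sin (p 0))) * μ₃)).congr_deriv ?_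
    ring
  have key : ∀ p : Fin 4 → ℝ, p 0 ∈ Set.Ioo 0 (π / 2) →
      -(pd 0 (pd 0 u) p) + (Real.sin (p 0) ^ 2)⁻¹ * pd 1 (pd 1 u) p
        + (Real.cos (p 0) ^ 2)⁻¹ * pd 2 (pd 2 u) p + pd 3 (pd 3 u) p
        + (Real.tan (p 0) - Real.cot (p 0)) * pd 0 u p
        + F (p 1 - Real.log (Real.sin (p 0))) * u p =
      (deriv (deriv σ) (p 1 - Real.log (Real.sin (p 0))) - 2 * deriv σ (p 1 - Real.log (Real.sin (p 0)))
        + (F (p 1 - Real.log (Real.sin (p 0))) + μ₃ ^ 2 - μ₆ * μ₇ * Real.exp (2 * (p 1 - Real.log (Real.sin (p 0))))) * σ (p 1 - Real.log (Real.sin (p 0)))) * Real.exp (μ₃ * p 3 - Real.cos (p 0) / Real.sin (p 0) / 2 * (μ₆ * Real.exp (p 1 - p 2) + μ₇ * Real.exp (p 1 + p 2))) := by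
    intro p hp
    have hs : 0 < Real.sin (p 0) := Real.sin_pos_of_pos_of_lt_pi hp.1 (by linarith [hp.2, Real.pi_pos])
    have hc : 0 < Real.cos (p 0) := Real.cos_pos_of_mem_Ioo ⟨by linarith [hp.1, Real.pi_pos], hp.2⟩
    rw [q0 p hs.ne', q1 p hs.ne', q2 p hs.ne', q3 p hs.ne', p0 p hs.ne', Real.tan_eq_sin_div_cos,
      Real.cot_eq_cos_div_sin, hu']
    have he : Real.exp (2 * (p 1 - Real.log (Real.sin (p 0)))) = Real.exp (p 1 - p 2) * Real.exp (p 1 + p 2) / Real.sin (p 0) ^ 2 := by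
      rw [eq_div_iff (by positivity)]
      nth_rewrite 2 [← Real.exp_log hs]
      rw [← Real.exp_nat_mul, ← Real.exp_add, ← Real.exp_add]
      congr 1
      push_cast
      ring
    rw [he]
    dsimp only
    have hsc := Real.sin_sq_add_cos_sq (p 0)
    generalize Real.exp (μ₃ * p 3 - Real.cos (p 0) / Real.sin (p 0) / 2 * (μ₆ * Real.exp (p 1 - p 2) + μ₇ * Real.exp (p 1 + p 2))) = e
    generalize σ (p 1 - Real.log (Real.sin (p 0))) = w
    generalize deriv σ (p 1 - Real.log (Real.sin (p 0))) = w1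
    generalize deriv (deriv σ) (p 1 - Real.log (Real.sin (p 0))) = w2
    generalize F (p 1 - Real.log (Real.sin (p 0))) = f
    generalize Real.exp (p 1 - p 2) = a
    generalize Real.exp (p 1 + p 2) = b
    generalize Real.sin (p 0) = s at *
    generalize Real.cos (p 0) = c at *
    have hs' := hs.ne'
    have hc' := hc.ne'
    linear_combination (norm := (field_simp; ring)) (e * (-w2 / s ^ 2 + w1 / s ^ 2
      + w * (μ₆ * a + μ₇ * b) ^ 2 / (4 * s ^ 4))) * hsc
  constructor
  · intro h ξ
    have hm : (![π / 4, ξ + Real.log (Real.sin (π / 4)), 0, 0] : Fin 4 → ℝ) 0 ∈ Set.Ioo 0 (π / 2) := by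
      constructor <;> simp <;> linarith [Real.pi_pos]
    have h1 := h _ hm
    rw [key _ hm] at h1
    have h2 := (mul_eq_zero.1 h1).resolve_right (Real.exp_pos _).ne'
    have h3 : (![π / 4, ξ + Real.log (Real.sin (π / 4)), 0, 0] : Fin 4 → ℝ) 1 -
      Real.log (Real.sin ((![π / 4, ξ + Real.log (Real.sin (π / 4)), 0, 0] : Fin 4 → ℝ) 0)) = ξ := by
      show ξ + Real.log (Real.sin (π / 4)) - Real.log (Real.sin (π / 4)) = ξ
      ring
    rw [h3] at h2
    exact h2
  · intro h p hp
    rw [key p hp, h, zero_mul]
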